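/- Let r > 0 and ξ = (ξ₁, ξ₂) ∈ ℂ². Then ∫_{B_r} exp( i·(ξ₁·x₁ + ξ₂·x₂) ) dx = π·r²·Σ_{m=0}^∞ (−1)^m/(m!·(m+1)!)·( r²·(ξ₁² + ξ₂²)/4 )^m, where B_r = {x ∈ ℝ² : x₁² + x₂² < r²}. (Equivalently, the complexified Fourier transform of the indicator function of the disk B_r is χ̂_{B_r}(ξ) = 2π·r·J₁( r·√(ξ₁²+ξ₂²) )/√(ξ₁²+ξ₂²), where J₁ is the Bessel function of the first kind of order 1; in particular χ̂_{B_r} vanishes identically on {ξ ∈ ℂ² : ξ₁²+ξ₂² = ρ} whenever ρ > 0 and r√ρ is a zero of J₁, so the disk fails the Pompeiu property.) -/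

import Mathlib

open Complex MeasureTheory

noncomputable section

theorem integral_exp_int_mul_I (k : ℤ) :
    (∫ θ in (-Real.pi)..Real.pi, Complex.exp ((k : ℂ) * Complex.I * (θ : ℂ))) =
      if k = 0 then (2 * Real.pi : ℂ) else 0 := by
  split_ifs with hk
  · subst hk
    simp
    ring
  · have hk' : (k : ℂ) * Complex.I ≠ 0 := by simp [hk]
    rw [integral_exp_mul_complex hk']
    have h : Complex.exp ((k : ℂ) * Complex.I * ((Real.pi : ℝ) : ℂ)) =
        Complex.exp ((k : ℂ) * Complex.I * ((-Real.pi : ℝ) : ℂ)) := by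
      rw [Complex.exp_eq_exp_iff_exists_int]
      exact ⟨k, by push_cast; ring⟩
    rw [h, sub_self, zero_div]

theorem integral_pow_mul_exp_add_mul_exp_neg (a b : ℂ) (n : ℕ) :
    (∫ θ in (-Real.pi)..Real.pi,
      (a * Complex.exp (Complex.I * (θ : ℂ)) + b * Complex.exp (-(Complex.I * (θ : ℂ)))) ^ n) =
      ∑ k ∈ Finset.range (n + 1),
        if 2 * k = n then 2 * Real.pi * (a ^ k * b ^ (n - k) * (n.choose k : ℂ)) else 0 := by
  have h : ∀ θ : ℝ,
      (a * Complex.exp (Complex.I * (θ : ℂ)) + b * Complex.exp (-(Complex.I * (θ : ℂ)))) ^ n =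
      ∑ k ∈ Finset.range (n + 1), (a ^ k * b ^ (n - k) * (n.choose k : ℂ)) *
        Complex.exp (((2 * k - n : ℤ) : ℂ) * Complex.I * (θ : ℂ)) := by
    intro θ
    rw [add_pow]
    refine Finset.sum_congr rfl fun k hk => ?_
    have hkn : k ≤ n := Nat.lt_succ_iff.mp (Finset.mem_range.mp hk)
    have he : Complex.exp (((2 * k - n : ℤ) : ℂ) * Complex.I * (θ : ℂ)) =
        Complex.exp (Complex.I * (θ : ℂ)) ^ k * Complex.exp (-(Complex.I * (θ : ℂ))) ^ (n - k) := by
      rw [← Complex.exp_nat_mul, ← Complex.exp_nat_mul, ← Complex.exp_add]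
      congr 1
      push_cast [Nat.cast_sub hkn]
      ring
    rw [he, mul_pow, mul_pow]
    ring
  simp_rw [h]
  rw [intervalIntegral.integral_finsetSum
    fun k _ => (by fun_prop : Continuous _).intervalIntegrable _ _]
  refine Finset.sum_congr rfl fun k _ => ?_
  rw [intervalIntegral.integral_const_mul, integral_exp_int_mul_I]
  have hiff : (2 * (k : ℤ) - n = 0) ↔ 2 * k = n := by omega
  simp only [hiff]
  split_ifs <;> ring

theorem mul_cos_add_mul_sin_eq (x y : ℂ) (θ : ℝ) :
    x * (Real.cos θ : ℂ) + y * (Real.sin θ : ℂ) =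
      (x - Complex.I * y) / 2 * Complex.exp (Complex.I * (θ : ℂ)) +
        (x + Complex.I * y) / 2 * Complex.exp (-(Complex.I * (θ : ℂ))) := by
  have h : -(Complex.I * (θ : ℂ)) = (-(θ : ℂ)) * Complex.I := by ring
  rw [h, mul_comm Complex.I (θ : ℂ), Complex.exp_mul_I, Complex.exp_mul_I, Complex.cos_neg,
    Complex.sin_neg, Complex.ofReal_cos, Complex.ofReal_sin]
  linear_combination (y * Complex.sin θ) * Complex.I_sq

theorem integral_mul_cos_add_mul_sin_pow_even (x y : ℂ) (m : ℕ) :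
    (∫ θ in (-Real.pi)..Real.pi, (x * (Real.cos θ : ℂ) + y * (Real.sin θ : ℂ)) ^ (2 * m)) =
      2 * Real.pi * ((x ^ 2 + y ^ 2) / 4) ^ m * ((2 * m).choose m : ℂ) := by
  simp_rw [mul_cos_add_mul_sin_eq]
  rw [integral_pow_mul_exp_add_mul_exp_neg, Finset.sum_eq_single m]
  · have h : (x ^ 2 + y ^ 2) / 4 = (x - Complex.I * y) / 2 * ((x + Complex.I * y) / 2) := by
      linear_combination (y ^ 2 / 4) * Complex.I_sq
    rw [if_pos rfl, h, mul_pow, show 2 * m - m = m by omega]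
    ring
  · intro k _ hk
    exact if_neg (by omega)
  · intro hm
    exact absurd (Finset.mem_range.mpr (by omega)) hm

theorem integral_mul_cos_add_mul_sin_pow_odd (x y : ℂ) {n : ℕ} (hn : Odd n) :
    (∫ θ in (-Real.pi)..Real.pi, (x * (Real.cos θ : ℂ) + y * (Real.sin θ : ℂ)) ^ n) = 0 := by
  obtain ⟨j, rfl⟩ := hn
  simp_rw [mul_cos_add_mul_sin_eq]
  rw [integral_pow_mul_exp_add_mul_exp_neg]
  exact Finset.sum_eq_zero fun k _ => if_neg (by omega)

theorem setIntegral_disk_eq_polar {E : Type*} [NormedAddCommGroup E] [NormedSpace ℝ E]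
    (f : ℝ × ℝ → E) {r : ℝ} (hr : 0 < r) :
    (∫ p in {p : ℝ × ℝ | p.1 ^ 2 + p.2 ^ 2 < r ^ 2}, f p) =
      ∫ q in Set.Ioo 0 r ×ˢ Set.Ioo (-Real.pi) Real.pi,
        q.1 • f (q.1 * Real.cos q.2, q.1 * Real.sin q.2) := by
  have hD : MeasurableSet {p : ℝ × ℝ | p.1 ^ 2 + p.2 ^ 2 < r ^ 2} :=
    measurableSet_lt (by fun_prop) (by fun_prop)
  have hS : MeasurableSet (Set.Ioo 0 r ×ˢ Set.Ioo (-Real.pi) Real.pi) :=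
    measurableSet_Ioo.prod measurableSet_Ioo
  rw [← integral_indicator hD, ← integral_comp_polarCoord_symm, ← integral_indicator hS,
    ← integral_indicator polarCoord.open_target.measurableSet]
  congr 1
  ext q
  have hq : (q.1 * Real.cos q.2) ^ 2 + (q.1 * Real.sin q.2) ^ 2 = q.1 ^ 2 := by
    linear_combination q.1 ^ 2 * Real.cos_sq_add_sin_sq q.2
  by_cases hpos : 0 < q.1
  · have hlt : q.1 ^ 2 < r ^ 2 ↔ q.1 < r := sq_lt_sq₀ hpos.le hr.le
    by_cases hqr : q.1 < r <;>
    simp [Set.indicator, polarCoord_target, polarCoord_symm_apply, hq, hlt, hpos, hqr]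
  · simp [Set.indicator, polarCoord_target, hpos]

theorem integral_polar_monomial (x y : ℂ) {r : ℝ} (hr : 0 < r) (n : ℕ) :
    (∫ q in Set.Ioo 0 r ×ˢ Set.Ioo (-Real.pi) Real.pi,
      (q.1 : ℂ) * ((Complex.I * (q.1 * (x * (Real.cos q.2 : ℂ) + y * (Real.sin q.2 : ℂ)))) ^ n /
        (n.factorial : ℂ))) =
      Complex.I ^ n / (n.factorial : ℂ) * ((r : ℂ) ^ (n + 2) / (n + 2)) *
        ∫ θ in (-Real.pi)..Real.pi, (x * (Real.cos θ : ℂ) + y * (Real.sin θ : ℂ)) ^ n := by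
  have hrad : (∫ ρ in Set.Ioo 0 r, Complex.I ^ n / (n.factorial : ℂ) * (ρ : ℂ) ^ (n + 1)) =
      Complex.I ^ n / (n.factorial : ℂ) * ((r : ℂ) ^ (n + 2) / (n + 2)) := by
    rw [← integral_Ioc_eq_integral_Ioo, ← intervalIntegral.integral_of_le hr.le,
      intervalIntegral.integral_const_mul]
    congr 1
    have h := integral_pow (a := 0) (b := r) (n + 1)
    have h' := congrArg (fun t : ℝ => (t : ℂ)) h
    simp only [← intervalIntegral.integral_ofReal] at h'
    push_cast at h'
    rw [h', zero_pow (by omega), sub_zero]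
    ring
  rw [← hrad, intervalIntegral.integral_of_le (by linarith [Real.pi_pos]),
    integral_Ioc_eq_integral_Ioo, Measure.volume_eq_prod, ← setIntegral_prod_mul]
  congr 1
  ext q
  rw [mul_pow, mul_pow]
  ring

theorem hasSum_integral_polar_exp (x y : ℂ) (r : ℝ) :
    HasSum (fun n : ℕ => ∫ q in Set.Ioo 0 r ×ˢ Set.Ioo (-Real.pi) Real.pi,
      (q.1 : ℂ) * ((Complex.I * (q.1 * (x * (Real.cos q.2 : ℂ) + y * (Real.sin q.2 : ℂ)))) ^ n /
        (n.factorial : ℂ)))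
      (∫ q in Set.Ioo 0 r ×ˢ Set.Ioo (-Real.pi) Real.pi,
        (q.1 : ℂ) * Complex.exp
          (Complex.I * (q.1 * (x * (Real.cos q.2 : ℂ) + y * (Real.sin q.2 : ℂ))))) := by
  have hS : MeasurableSet (Set.Ioo 0 r ×ˢ Set.Ioo (-Real.pi) Real.pi) :=
    measurableSet_Ioo.prod measurableSet_Ioo
  have : IsFiniteMeasure
      ((volume : Measure (ℝ × ℝ)).restrict (Set.Ioo 0 r ×ˢ Set.Ioo (-Real.pi) Real.pi)) := by
    refine ⟨?_⟩
    rw [Measure.restrict_apply_univ]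
    exact ((Metric.isBounded_Ioo 0 r).prod (Metric.isBounded_Ioo _ _)).measure_lt_top
  have hsum : Summable fun n : ℕ => r * ((r * (‖x‖ + ‖y‖)) ^ n / (n.factorial : ℝ)) :=
    (Real.summable_pow_div_factorial _).mul_left r
  refine hasSum_integral_of_dominated_convergence
    (fun n _ => r * ((r * (‖x‖ + ‖y‖)) ^ n / (n.factorial : ℝ))) (fun n => ?_) (fun n => ?_)
    (Filter.Eventually.of_forall fun _ => hsum) (integrable_const _)
    (Filter.Eventually.of_forall fun q => ?_)
  · exact (by fun_prop : Continuous _).aestronglyMeasurable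
  · filter_upwards [ae_restrict_mem hS] with q hq
    obtain ⟨⟨h0, h1⟩, -⟩ := hq
    have hlin : ‖x * (Real.cos q.2 : ℂ) + y * (Real.sin q.2 : ℂ)‖ ≤ ‖x‖ + ‖y‖ := by
      refine (norm_add_le _ _).trans ?_
      rw [norm_mul, norm_mul, Complex.norm_real, Complex.norm_real]
      exact add_le_add
        (mul_le_of_le_one_right (norm_nonneg _) (Real.abs_cos_le_one _))
        (mul_le_of_le_one_right (norm_nonneg _) (Real.abs_sin_le_one _))
    rw [norm_mul, norm_div, norm_pow, norm_mul, norm_mul, Complex.norm_I, one_mul,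
      Complex.norm_real, Real.norm_of_nonneg h0.le, Complex.norm_natCast]
    have hr : 0 ≤ r := (h0.trans h1).le
    gcongr
  · refine HasSum.mul_left _ ?_
    rw [Complex.exp_eq_exp_ℂ]
    exact NormedSpace.expSeries_div_hasSum_exp _

theorem stmt17 (r : ℝ) (hr : 0 < r) (ξ : ℂ × ℂ) :
    (∫ p in {p : ℝ × ℝ | p.1 ^ 2 + p.2 ^ 2 < r ^ 2},
      Complex.exp (Complex.I * (ξ.1 * (p.1 : ℂ) + ξ.2 * (p.2 : ℂ)))) =
    (Real.pi : ℂ) * (r : ℂ) ^ 2 *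
      ∑' m : ℕ, ((-1 : ℂ) ^ m / ((Nat.factorial m : ℂ) * (Nat.factorial (m + 1) : ℂ)))
        * ((r : ℂ) ^ 2 * (ξ.1 ^ 2 + ξ.2 ^ 2) / 4) ^ m := by
  have h := hasSum_integral_polar_exp ξ.1 ξ.2 r
  simp_rw [integral_polar_monomial _ _ hr] at h
  rw [← (mul_right_injective₀ (two_ne_zero' ℕ)).hasSum_iff] at h
  · rw [setIntegral_disk_eq_polar _ hr, ← tsum_mul_left]
    trans
    · refine Eq.trans ?_ h.tsum_eq.symm
      congr 1
      ext q
      rw [Complex.real_smul]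
      congr 3
      push_cast
      ring
    · refine tsum_congr fun m => ?_
      have hc : ((2 * m).choose m : ℂ) * m.factorial * m.factorial = (2 * m).factorial := by
        have := Nat.choose_mul_factorial_mul_factorial (show m ≤ 2 * m by omega)
        rw [show 2 * m - m = m by omega] at this
        exact_mod_cast this
      have hm : (m.factorial : ℂ) ≠ 0 := by exact_mod_cast m.factorial_ne_zero
      have h2m : ((2 * m).factorial : ℂ) ≠ 0 := by exact_mod_cast (2 * m).factorial_ne_zero
      have hm1 : (m : ℂ) + 1 ≠ 0 := by exact_mod_cast m.succ_ne_zero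
      have hm2 : 2 * (m : ℂ) + 2 ≠ 0 := by
        rw [show 2 * (m : ℂ) + 2 = 2 * (m + 1) by ring]
        exact mul_ne_zero two_ne_zero hm1
      simp only [Function.comp_apply]
      rw [integral_mul_cos_add_mul_sin_pow_even, pow_mul, Complex.I_sq, Nat.factorial_succ,
        mul_div_assoc, mul_pow ((r : ℂ) ^ 2), ← pow_mul (r : ℂ), pow_add (r : ℂ)]
      generalize ((ξ.1 ^ 2 + ξ.2 ^ 2) / 4) ^ m = s
      rw [← hc] at h2m ⊢
      have hch : ((2 * m).choose m : ℂ) ≠ 0 := fun h0 => h2m (by simp [h0])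
      push_cast
      field_simp
  · intro n hn
    have hodd : Odd n := by
      rw [← Nat.not_even_iff_odd]
      rintro ⟨k, rfl⟩
      exact hn ⟨k, by simp; ring⟩
    rw [integral_mul_cos_add_mul_sin_pow_odd _ _ hodd, mul_zero]
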